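/- Let N ≥ 3, let α(N) denote the Lebesgue measure of the unit ball of ℝ^N, and for n ∈ ℕ define G_n(x,y) = (N(N−2)α(N))^{−1} ( n²/(1+n²|x−y|²) )^{(N−2)/2} for x,y ∈ ℝ^N. Then for every f ∈ L^∞(ℝ^N) with compact support and for almost every y ∈ ℝ^N (namely every Lebesgue point of f), lim_{n→∞} ∫_{ℝ^N} Δ_x G_n(x,y) f(x) dx = −f(y), where Δ_x denotes the Laplacian in the x variable. -/

import Mathlib

open MeasureTheory Set Metric Filter
open scoped ENNReal Topology

noncomputable section

abbrev Eu (N : ℕ) := EuclideanSpace ℝ (Fin N)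

/-- The Laplacian of a function on `ℝ^N`, as the sum of the pure second derivatives along the
standard basis directions. -/
def lap {N : ℕ} (f : Eu N → ℝ) (x : Eu N) : ℝ :=
  ∑ i : Fin N, fderiv ℝ (fun y => fderiv ℝ f y (EuclideanSpace.single i 1)) x
    (EuclideanSpace.single i 1)

/-- `α(N)`: the Lebesgue measure of the unit ball of `ℝ^N`. -/
def alphaN (N : ℕ) : ℝ := (volume (ball (0 : Eu N) 1)).toReal

/-- The smooth approximations `G_n` of the Green function of `-Δ` on `ℝ^N`. -/
def Gapp (N : ℕ) (n : ℕ) (x y : Eu N) : ℝ :=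
  ((N : ℝ) * ((N : ℝ) - 2) * alphaN N)⁻¹ *
    ((n : ℝ) ^ 2 / (1 + (n : ℝ) ^ 2 * ‖x - y‖ ^ 2)) ^ (((N : ℝ) - 2) / 2)

section Laplacian

variable {N : ℕ}

lemma hasFDerivAt_one_add_mul_norm_sub_sq (a : ℝ) (y x : Eu N) :
    HasFDerivAt (fun x' : Eu N => 1 + a * ‖x' - y‖ ^ 2) ((2 * a) • innerSL ℝ (x - y)) x := by
  have h := ((hasStrictFDerivAt_norm_sq (x - y)).hasFDerivAt.comp x
    ((hasFDerivAt_id x).sub_const y)).const_mul a |>.const_add 1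
  refine h.congr_fderiv ?_
  ext v
  simp
  ring

lemma hasFDerivAt_one_add_mul_norm_sub_sq_rpow {a : ℝ} (ha : 0 ≤ a) (q : ℝ) (y x : Eu N) :
    HasFDerivAt (fun x' : Eu N => (1 + a * ‖x' - y‖ ^ 2) ^ q)
      ((q * (1 + a * ‖x - y‖ ^ 2) ^ (q - 1)) • (2 * a) • innerSL ℝ (x - y)) x :=
  (hasFDerivAt_one_add_mul_norm_sub_sq a y x).rpow_const (Or.inl (by positivity))

lemma lap_const_mul_one_add_mul_norm_sub_sq_rpow {a : ℝ} (ha : 0 ≤ a) (c q : ℝ) (y x : Eu N) :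
    lap (fun x' : Eu N => c * (1 + a * ‖x' - y‖ ^ 2) ^ q) x =
      c * (2 * a * q) * (N * (1 + a * ‖x - y‖ ^ 2) ^ (q - 1) +
        (q - 1) * (2 * a) * ‖x - y‖ ^ 2 * (1 + a * ‖x - y‖ ^ 2) ^ (q - 2)) := by
  have hfirst (i : Fin N) : (fun z : Eu N => fderiv ℝ
      (fun x' : Eu N => c * (1 + a * ‖x' - y‖ ^ 2) ^ q) z (EuclideanSpace.single i 1)) =
      fun z => c * (2 * a * q) * ((1 + a * ‖z - y‖ ^ 2) ^ (q - 1) * (z i - y i)) := by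
    funext z
    rw [((hasFDerivAt_one_add_mul_norm_sub_sq_rpow ha q y z).const_mul c).fderiv]
    simp [EuclideanSpace.inner_single_right]
    ring
  have hcoord (i : Fin N) : HasFDerivAt (fun z : Eu N => z i - y i)
      (EuclideanSpace.proj i : Eu N →L[ℝ] ℝ) x :=
    (EuclideanSpace.proj i : Eu N →L[ℝ] ℝ).hasFDerivAt.sub_const (y i)
  have hsecond (i : Fin N) : fderiv ℝ (fun z : Eu N => fderiv ℝ
      (fun x' : Eu N => c * (1 + a * ‖x' - y‖ ^ 2) ^ q) z (EuclideanSpace.single i 1)) x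
      (EuclideanSpace.single i 1) =
      c * (2 * a * q) * ((1 + a * ‖x - y‖ ^ 2) ^ (q - 1) +
        (q - 1) * (2 * a) * (x i - y i) ^ 2 * (1 + a * ‖x - y‖ ^ 2) ^ (q - 2)) := by
    have hprod := (hasFDerivAt_one_add_mul_norm_sub_sq_rpow ha (q - 1) y x).fun_mul (hcoord i)
    rw [hfirst, (hprod.const_mul _).fderiv, show q - 2 = q - 1 - 1 by ring]
    simp [EuclideanSpace.inner_single_right]
    ring
  have hnorm : ‖x - y‖ ^ 2 = ∑ i, (x i - y i) ^ 2 := by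
    simp [EuclideanSpace.norm_sq_eq]
  simp only [lap, hsecond]
  rw [← Finset.mul_sum, Finset.sum_add_distrib, ← Finset.sum_mul, ← Finset.mul_sum, ← hnorm]
  simp

lemma alphaN_pos (N : ℕ) : 0 < alphaN N :=
  ENNReal.toReal_pos (measure_ball_pos volume 0 one_pos).ne' measure_ball_lt_top.ne

lemma lap_Gapp (hN : 3 ≤ N) {n : ℕ} (hn : 0 < n) (y x : Eu N) :
    lap (fun x' => Gapp N n x' y) x =
      -((n : ℝ) ^ N *
        ((alphaN N)⁻¹ * (1 + ‖(n : ℝ) • (x - y)‖ ^ 2) ^ (-((N : ℝ) + 2) / 2))) := by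
  have hn' : (0 : ℝ) < n := by exact_mod_cast hn
  have hN' : (3 : ℝ) ≤ N := by exact_mod_cast hN
  have hα := (alphaN_pos N).ne'
  set p : ℝ := ((N : ℝ) - 2) / 2 with hp
  have hG : (fun x' => Gapp N n x' y) = fun x' : Eu N =>
      (((N : ℝ) * ((N : ℝ) - 2) * alphaN N)⁻¹ * ((n : ℝ) ^ 2) ^ p) *
        (1 + (n : ℝ) ^ 2 * ‖x' - y‖ ^ 2) ^ (-p) := by
    funext x'
    rw [Gapp, Real.div_rpow (by positivity) (by positivity), Real.rpow_neg (by positivity)]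
    ring
  rw [hG, lap_const_mul_one_add_mul_norm_sub_sq_rpow (by positivity)]
  have hpow : (n : ℝ) ^ N = ((n : ℝ) ^ 2) ^ p * (n : ℝ) ^ 2 := by
    rw [← Real.rpow_natCast (n : ℝ) 2, ← Real.rpow_mul hn'.le, ← Real.rpow_add hn',
      ← Real.rpow_natCast]
    congr 1
    push_cast
    ring
  have hnorm : ‖(n : ℝ) • (x - y)‖ ^ 2 = (n : ℝ) ^ 2 * ‖x - y‖ ^ 2 := by
    rw [norm_smul, mul_pow, Real.norm_natCast]
  have hφ : (0 : ℝ) < 1 + (n : ℝ) ^ 2 * ‖x - y‖ ^ 2 := by positivity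
  rw [hnorm, hpow, show -((N : ℝ) + 2) / 2 = -p - 2 by rw [hp]; ring,
    show -p - 1 = (-p - 2) + 1 by ring, Real.rpow_add_one hφ.ne']
  have h2 : (N : ℝ) - 2 ≠ 0 := by linarith
  have h0 : (N : ℝ) ≠ 0 := by linarith
  generalize (1 + (n : ℝ) ^ 2 * ‖x - y‖ ^ 2) ^ (-p - 2) = A
  generalize ((n : ℝ) ^ 2) ^ p = B
  rw [hp]
  field_simp
  ring

end Laplacian

section Mass

lemma hasDerivAt_pow_mul_one_add_sq_rpow {N : ℕ} (r : ℝ) :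
    HasDerivAt (fun r : ℝ => r ^ N * (1 + r ^ 2) ^ (-(N : ℝ) / 2))
      (N * (r ^ (N - 1) * (1 + r ^ 2) ^ (-((N : ℝ) + 2) / 2))) r := by
  have hpos : (0 : ℝ) < 1 + r ^ 2 := by positivity
  have h := (hasDerivAt_pow N r).mul
    (((hasDerivAt_pow 2 r).const_add 1).rpow_const (p := -(N : ℝ) / 2) (Or.inl hpos.ne'))
  refine h.congr_deriv ?_
  rw [show -(N : ℝ) / 2 - 1 = -((N : ℝ) + 2) / 2 by ring,
    show -(N : ℝ) / 2 = -((N : ℝ) + 2) / 2 + 1 by ring, Real.rpow_add_one hpos.ne']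
  rcases N with _ | N
  · simp
  · simp
    ring

lemma tendsto_pow_mul_one_add_sq_rpow (N : ℕ) :
    Tendsto (fun r : ℝ => r ^ N * (1 + r ^ 2) ^ (-(N : ℝ) / 2)) atTop (𝓝 1) := by
  have hinv : Tendsto (fun r : ℝ => (1 + (r ^ 2)⁻¹) ^ (-(N : ℝ) / 2)) atTop (𝓝 1) := by
    have h : Tendsto (fun r : ℝ => 1 + (r ^ 2)⁻¹) atTop (𝓝 1) := by
      simpa using (tendsto_inv_atTop_zero.comp
        (tendsto_pow_atTop (α := ℝ) two_ne_zero)).const_add 1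
    simpa using h.rpow_const (p := -(N : ℝ) / 2) (Or.inl one_ne_zero)
  refine hinv.congr' ?_
  filter_upwards [eventually_gt_atTop 0] with r hr
  have hsplit : 1 + r ^ 2 = r ^ 2 * (1 + (r ^ 2)⁻¹) := by
    field_simp
    ring
  have hrN : r ^ N * (r ^ 2) ^ (-(N : ℝ) / 2) = 1 := by
    rw [← Real.rpow_natCast r N, ← Real.rpow_natCast r 2, ← Real.rpow_mul hr.le,
      ← Real.rpow_add hr, ← Real.rpow_zero r]
    congr 1
    push_cast
    ring
  rw [hsplit, Real.mul_rpow (by positivity) (by positivity), ← mul_assoc, hrN, one_mul]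

lemma integral_one_add_norm_sq_rpow {N : ℕ} (hN : N ≠ 0) :
    ∫ z : Eu N, (1 + ‖z‖ ^ 2) ^ (-((N : ℝ) + 2) / 2) = alphaN N := by
  have : NeZero N := ⟨hN⟩
  have hradial : ∫ r in Ioi (0 : ℝ), N * (r ^ (N - 1) * (1 + r ^ 2) ^ (-((N : ℝ) + 2) / 2)) =
      1 := by
    rw [integral_Ioi_of_hasDerivAt_of_nonneg'
      (fun r _ => hasDerivAt_pow_mul_one_add_sq_rpow r) (fun r hr => ?_)
      (tendsto_pow_mul_one_add_sq_rpow N)]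
    · simp [hN]
    · have : (0 : ℝ) < r := hr
      positivity
  rw [integral_const_mul] at hradial
  rw [integral_fun_norm_addHaar volume (fun r : ℝ => (1 + r ^ 2) ^ (-((N : ℝ) + 2) / 2))]
  simp only [finrank_euclideanSpace, Fintype.card_fin, nsmul_eq_mul, smul_eq_mul]
  rw [mul_left_comm, hradial, mul_one]
  rfl

end Mass

section Convergence

variable {E : Type*} [NormedAddCommGroup E] [MeasurableSpace E] [BorelSpace E] {μ : Measure E}

lemma exists_setIntegral_compl_closedBall_lt {K : E → ℝ} (hK : Integrable K μ) {ε : ℝ}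
    (hε : 0 < ε) : ∃ R : ℝ, 0 < R ∧ ∫ z in (closedBall 0 R)ᶜ, |K z| ∂μ < ε := by
  have hlim : Tendsto (fun R : ℝ => ∫ z in closedBall 0 R, |K z| ∂μ) atTop
      (𝓝 (∫ z, |K z| ∂μ)) :=
    (aecover_closedBall tendsto_id).integral_tendsto_of_countably_generated hK.abs
  obtain ⟨R, hR, hRpos⟩ :=
    ((hlim.eventually_const_lt (sub_lt_self _ hε)).and (eventually_gt_atTop 0)).exists
  refine ⟨R, hRpos, ?_⟩
  have := integral_add_compl (measurableSet_closedBall (x := (0 : E)) (ε := R)) hK.abs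
  linarith

variable [NormedSpace ℝ E] [FiniteDimensional ℝ E] [μ.IsAddHaarMeasure]

lemma tendsto_integral_mul_of_tendsto_setIntegral_closedBall {K : E → ℝ} (hK : Integrable K μ)
    {C M : ℝ} (hC : ∀ z, |K z| ≤ C) {g : ℕ → E → ℝ} (hgm : ∀ n, Measurable (g n))
    (hg : ∀ n z, |g n z| ≤ M)
    (hlim : ∀ R > 0, Tendsto (fun n => ∫ z in closedBall 0 R, |g n z| ∂μ) atTop (𝓝 0)) :
    Tendsto (fun n => ∫ z, K z * g n z ∂μ) atTop (𝓝 0) := by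
  have hM : 0 ≤ M := (abs_nonneg _).trans (hg 0 0)
  have hint (n : ℕ) : Integrable (fun z => K z * g n z) μ :=
    hK.mul_bdd (hgm n).aestronglyMeasurable (Eventually.of_forall (hg n))
  rw [Metric.tendsto_atTop']
  intro ε hε
  obtain ⟨R, hR, htail⟩ := exists_setIntegral_compl_closedBall_lt hK
    (show 0 < ε / (2 * (M + 1)) by positivity)
  have hinner : Tendsto (fun n => C * ∫ z in closedBall 0 R, |g n z| ∂μ) atTop (𝓝 0) := by
    simpa using (hlim R hR).const_mul C
  obtain ⟨n₀, hn₀⟩ := eventually_atTop.1 (hinner.eventually_lt_const (half_pos hε))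
  refine ⟨n₀, fun n hn => ?_⟩
  have hgR : IntegrableOn (fun z => |g n z|) (closedBall 0 R) μ :=
    (Measure.integrableOn_of_bounded measure_closedBall_lt_top.ne
      (hgm n).aestronglyMeasurable (Eventually.of_forall (hg n))).abs
  have hball : ∫ z in closedBall 0 R, |K z * g n z| ∂μ ≤
      C * ∫ z in closedBall 0 R, |g n z| ∂μ := by
    rw [← integral_const_mul]
    refine integral_mono (hint n).abs.integrableOn (hgR.const_mul C) fun z => ?_
    simp only [abs_mul]
    exact mul_le_mul_of_nonneg_right (hC z) (abs_nonneg _)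
  have hcompl : ∫ z in (closedBall 0 R)ᶜ, |K z * g n z| ∂μ ≤
      (∫ z in (closedBall 0 R)ᶜ, |K z| ∂μ) * M := by
    rw [← integral_mul_const]
    refine integral_mono (hint n).abs.integrableOn (hK.abs.integrableOn.mul_const M) fun z => ?_
    simp only [abs_mul]
    exact mul_le_mul_of_nonneg_left (hg n z) (abs_nonneg _)
  have htail' : (∫ z in (closedBall 0 R)ᶜ, |K z| ∂μ) * M ≤ ε / 2 := calc
    _ ≤ ε / (2 * (M + 1)) * (M + 1) := by
      gcongr
      linarith
    _ = ε / 2 := by field_simp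
  have hsum := integral_add_compl (measurableSet_closedBall (x := (0 : E)) (ε := R)) (hint n).abs
  rw [Real.dist_0_eq_abs]
  have := abs_integral_le_integral_abs (μ := μ) (f := fun z => K z * g n z)
  linarith [hn₀ n hn.le]

lemma setIntegral_closedBall_comp_add_inv_smul (F : E → ℝ) (y : E) {R t : ℝ} (hR : 0 < R)
    (ht : 0 < t) :
    ∫ z in closedBall 0 R, F (y + t⁻¹ • z) ∂μ =
      μ.real (closedBall 0 R) * ⨍ x in closedBall y (t⁻¹ * R), F x ∂μ := by
  have htrans : ∫ z in closedBall 0 (t⁻¹ * R), F (y + z) ∂μ =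
      ∫ x in closedBall y (t⁻¹ * R), F x ∂μ := by
    have h := (measurePreserving_add_left μ y).setIntegral_preimage_emb
      (measurableEmbedding_addLeft y) F (closedBall y (t⁻¹ * R))
    rwa [preimage_add_closedBall, sub_self] at h
  rw [Measure.setIntegral_comp_smul_of_pos μ (fun z => F (y + z)) _ (inv_pos.2 ht),
    smul_closedBall _ _ hR.le, smul_zero, Real.norm_of_nonneg (inv_pos.2 ht).le, htrans,
    setAverage_eq, smul_eq_mul, smul_eq_mul,
    Measure.addHaar_real_closedBall μ y (by positivity),
    Measure.addHaar_real_closedBall μ 0 hR.le, ← mul_assoc]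
  congr 1
  have : μ.real (ball 0 1) ≠ 0 :=
    (ENNReal.toReal_pos (measure_ball_pos μ 0 one_pos).ne' measure_ball_lt_top.ne).ne'
  have hRd : R ^ Module.finrank ℝ E ≠ 0 := (pow_pos hR _).ne'
  rw [mul_pow]
  field_simp

lemma ae_tendsto_integral_mul_comp_add_inv_smul {K : E → ℝ} (hK : Integrable K μ) {C M : ℝ}
    (hC : ∀ z, |K z| ≤ C) {f : E → ℝ} (hfm : Measurable f) (hf : ∀ x, |f x| ≤ M) :
    ∀ᵐ y ∂μ, Tendsto (fun n : ℕ => ∫ z, K z * f (y + (n : ℝ)⁻¹ • z) ∂μ) atTop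
      (𝓝 ((∫ z, K z ∂μ) * f y)) := by
  have hloc : LocallyIntegrable f μ := (locallyIntegrable_const M).mono
    hfm.aestronglyMeasurable (Eventually.of_forall fun x => (hf x).trans (le_abs_self M))
  filter_upwards [IsUnifLocDoublingMeasure.ae_tendsto_average_norm_sub μ hloc 1] with y hy
  have hlim : ∀ R > 0, Tendsto (fun n : ℕ =>
      ∫ z in closedBall 0 R, |f (y + (n : ℝ)⁻¹ • z) - f y| ∂μ) atTop (𝓝 0) := by
    intro R hR
    have hδ : Tendsto (fun n : ℕ => (n : ℝ)⁻¹ * R) atTop (𝓝[>] 0) := by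
      refine tendsto_nhdsWithin_iff.2 ⟨?_, ?_⟩
      · simpa using (tendsto_inv_atTop_nhds_zero_nat (𝕜 := ℝ)).mul_const R
      · filter_upwards [eventually_gt_atTop 0] with n hn
        have : (0 : ℝ) < n := by exact_mod_cast hn
        exact mem_Ioi.2 (by positivity)
    have havg := (hy (fun _ => y) _ hδ (Eventually.of_forall fun n =>
      mem_closedBall_self (by positivity))).const_mul (μ.real (closedBall 0 R))
    rw [mul_zero] at havg
    refine havg.congr' ?_
    filter_upwards [eventually_gt_atTop 0] with n hn
    exact (setIntegral_closedBall_comp_add_inv_smul (fun x => |f x - f y|) y hR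
      (by exact_mod_cast hn)).symm
  have hmeas (n : ℕ) : Measurable fun z : E => f (y + (n : ℝ)⁻¹ • z) := by fun_prop
  have hzero := tendsto_integral_mul_of_tendsto_setIntegral_closedBall hK hC
    (g := fun n z => f (y + (n : ℝ)⁻¹ • z) - f y) (M := M + M)
    (fun n => (hmeas n).sub_const _)
    (fun n z => (abs_sub _ _).trans (add_le_add (hf _) (hf _))) hlim
  refine tendsto_sub_nhds_zero_iff.1 (hzero.congr fun n => ?_)
  rw [← integral_mul_const, ← integral_sub]
  · simp only [mul_sub]
  · exact hK.mul_bdd (hmeas n).aestronglyMeasurable (Eventually.of_forall fun z => hf _)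
  · exact hK.mul_const _

lemma integral_pow_finrank_mul_comp_smul_sub (K f : E → ℝ) (y : E) {t : ℝ} (ht : 0 < t) :
    ∫ x, t ^ Module.finrank ℝ E * K (t • (x - y)) * f x ∂μ =
      ∫ z, K z * f (y + t⁻¹ • z) ∂μ := by
  have hshift := integral_sub_right_eq_self (μ := μ)
    (fun w => t ^ Module.finrank ℝ E * K (t • w) * f (y + w)) y
  have hscale := Measure.integral_comp_smul μ (fun z => K z * f (y + t⁻¹ • z)) t
  simp only [add_sub_cancel] at hshift
  simp only [inv_smul_smul₀ ht.ne'] at hscale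
  rw [hshift]
  simp only [mul_assoc]
  rw [integral_const_mul, hscale, abs_of_pos (by positivity), smul_eq_mul,
    mul_inv_cancel_left₀ (by positivity)]

end Convergence

/-- **Lemma 3.1, property \eqref{green-lapl}**: for every bounded measurable `f` with compact
support and almost every `y ∈ ℝ^N` (namely every Lebesgue point of `f`),
`∫ Δ_x G_n(x,y) f(x) dx → -f(y)` as `n → ∞`. -/
theorem stmt_7 {N : ℕ} (hN : 3 ≤ N) (f : Eu N → ℝ)
    (hmeas : Measurable f) (hbdd : ∃ M : ℝ, ∀ x, |f x| ≤ M)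
    (hsupp : HasCompactSupport f) :
    ∀ᵐ y ∂(volume : Measure (Eu N)),
      Tendsto (fun n : ℕ => ∫ x, lap (fun x' => Gapp N n x' y) x * f x)
        atTop (𝓝 (-f y)) := by
  obtain ⟨M, hM⟩ := hbdd
  have hN0 : N ≠ 0 := by omega
  set K : Eu N → ℝ := fun z => (alphaN N)⁻¹ * (1 + ‖z‖ ^ 2) ^ (-((N : ℝ) + 2) / 2) with hKdef
  have hK : Integrable K volume :=
    (integrable_rpow_neg_one_add_norm_sq (by simp)).const_mul _
  have hα := alphaN_pos N
  have hC (z : Eu N) : |K z| ≤ (alphaN N)⁻¹ := by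
    rw [abs_of_nonneg (by positivity)]
    refine mul_le_of_le_one_right (by positivity) ?_
    refine Real.rpow_le_one_of_one_le_of_nonpos (by nlinarith [norm_nonneg z]) ?_
    have : (0 : ℝ) ≤ N := N.cast_nonneg
    linarith
  have hK1 : ∫ z, K z = 1 := by
    rw [hKdef, integral_const_mul, integral_one_add_norm_sq_rpow hN0, inv_mul_cancel₀ hα.ne']
  filter_upwards [ae_tendsto_integral_mul_comp_add_inv_smul hK hC hmeas hM] with y hy
  rw [hK1, one_mul] at hy
  refine hy.neg.congr' ?_
  filter_upwards [eventually_gt_atTop 0] with n hn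
  rw [← integral_pow_finrank_mul_comp_smul_sub K f y (by exact_mod_cast hn), ← integral_neg]
  simp only [lap_Gapp hN hn, finrank_euclideanSpace, Fintype.card_fin, hKdef, neg_mul]
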